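/- Let 1 < p < ∞, let d ≥ 1 be an integer, let 0 < δ ≤ 1, and let λ, N satisfy 0 < λ ≤ N. There exists a constant c > 0, depending only on p, d, δ and ψ, such that: if f : ℝ^d × ℝ^d → [0,1] is a measurable function supported in [0,N]^d × [0,N]^d with ∫_{[0,N]^{2d}} f ≥ δ N^{2d}, then M_λ^1(f) ≥ c N^{2d}. -/

import Mathlib

open MeasureTheory

/-- The Fourier transform `ψ̂(ξ) = ∫ ψ(x) e^{-2πi xξ} dx` of a function on `ℝ`. -/
noncomputable def psiHat (ψ : ℝ → ℝ) : ℝ → ℂ :=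
  fun ξ => ∫ x : ℝ, Complex.exp (-2 * Real.pi * Complex.I * (x * ξ)) * (ψ x : ℂ)

/-- The approximant `ω_λ^ε(s) = λ^{-d} ε^{-1} ψ̂(ε^{-1}(1 - ‖λ^{-1}s‖_{ℓ^p}^p))`. -/
noncomputable def omegaFn (ψ : ℝ → ℝ) (p : ℝ) (d : ℕ) (lam ε : ℝ) (s : Fin d → ℝ) : ℝ :=
  (lam ^ d)⁻¹ * ε⁻¹ * (psiHat ψ (ε⁻¹ * (1 - ∑ i, |lam⁻¹ * s i| ^ p))).re

/-- The counting form `M_λ^ε(f)` for corners with side distribution `ω_λ^ε`. -/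
noncomputable def Mform (ψ : ℝ → ℝ) (p : ℝ) (d : ℕ) (lam ε : ℝ)
    (f : (Fin d → ℝ) × (Fin d → ℝ) → ℝ) : ℝ :=
  ∫ x : Fin d → ℝ, ∫ y : Fin d → ℝ, ∫ s : Fin d → ℝ,
    f (x, y) * f (x + s, y) * f (x, y + s) * omegaFn ψ p d lam ε s

/-- A supersaturated, functional form of the corners theorem on `{0, …, n - 1}²`. -/
theorem exists_corner_sum_lower_bound (ε : ℝ) (hε : 0 < ε) :
    ∃ n : ℕ, 0 < n ∧ ∃ c : ℝ, 0 < c ∧ ∀ g : ℤ → ℤ → ℝ, (∀ i j, g i j ∈ Set.Icc (0 : ℝ) 1) →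
      c * (∑ i ∈ Finset.range n, ∑ j ∈ Finset.range n, g i j - ε * n ^ 2) ≤
        ∑ i ∈ Finset.range n, ∑ j ∈ Finset.range n, ∑ k ∈ (Finset.range n).erase i,
          g i j * g k j * g i (j + (k - i)) := by
  set n := cornersTheoremBound (ε / 2 / 9) + 1 with hn
  have hn0 : (0 : ℝ) < n := by positivity
  refine ⟨n, by omega, (ε / 2) ^ 3 / n ^ 2, by positivity, fun g hg => ?_⟩
  have hnn : ∀ i j k : ℕ, 0 ≤ g i j * g k j * g i (j + (k - i)) := fun i j k =>
    mul_nonneg (mul_nonneg (hg _ _).1 (hg _ _).1) (hg _ _).1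
  have hT : 0 ≤ ∑ i ∈ Finset.range n, ∑ j ∈ Finset.range n, ∑ k ∈ (Finset.range n).erase i,
      g i j * g k j * g i (j + (k - i)) :=
    Finset.sum_nonneg fun i _ => Finset.sum_nonneg fun j _ => Finset.sum_nonneg fun k _ =>
      hnn i j k
  rcases le_or_gt (∑ i ∈ Finset.range n, ∑ j ∈ Finset.range n, g i j) (ε * n ^ 2) with h | h
  · exact (mul_nonpos_of_nonneg_of_nonpos (by positivity) (by linarith)).trans hT
  let A : Finset (ℕ × ℕ) :=
    (Finset.range n ×ˢ Finset.range n).filter fun q => ε / 2 ≤ g q.1 q.2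
  have hsum : ∑ i ∈ Finset.range n, ∑ j ∈ Finset.range n, g i j ≤ A.card + ε / 2 * n ^ 2 := by
    rw [← Finset.sum_product']
    calc ∑ q ∈ Finset.range n ×ˢ Finset.range n, g q.1 q.2
        ≤ ∑ q ∈ Finset.range n ×ˢ Finset.range n,
            ((if ε / 2 ≤ g q.1 q.2 then (1 : ℝ) else 0) + ε / 2) := by
          refine Finset.sum_le_sum fun q _ => ?_
          split_ifs with hq
          · linarith [(hg q.1 q.2).2]
          · linarith
      _ = _ := by
          rw [Finset.sum_add_distrib, Finset.sum_boole]
          simp [A]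
          ring
  have hA := corners_theorem_nat (ε := ε / 2) (by positivity) (n := n) (by omega) A
    (Finset.filter_subset _ _) (by linarith)
  simp only [IsCornerFree] at hA
  push Not at hA
  obtain ⟨x₁, y₁, x₂, y₂, ⟨h₁, h₂, h₃, h₄⟩, hne⟩ := hA
  simp only [A, Finset.coe_filter, Finset.mem_product, Finset.mem_range, Set.mem_ofPred_eq]
    at h₁ h₂ h₃
  have hy : (y₂ : ℤ) = y₁ + (x₂ - x₁) := by omega
  have hle : g x₁ y₁ * g x₂ y₁ * g x₁ (y₁ + (x₂ - x₁)) ≤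
      ∑ i ∈ Finset.range n, ∑ j ∈ Finset.range n, ∑ k ∈ (Finset.range n).erase i,
        g i j * g k j * g i (j + (k - i)) := by
    refine le_trans ?_ (Finset.single_le_sum (fun i _ => Finset.sum_nonneg fun j _ =>
      Finset.sum_nonneg fun k _ => hnn i j k) (Finset.mem_range.2 h₁.1.1))
    refine le_trans ?_ (Finset.single_le_sum (fun j _ => Finset.sum_nonneg fun k _ => hnn x₁ j k)
      (Finset.mem_range.2 h₁.1.2))
    exact Finset.single_le_sum (f := fun k : ℕ => g x₁ y₁ * g k y₁ * g x₁ (y₁ + (k - x₁)))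
      (fun k _ => hnn x₁ y₁ k)
      (Finset.mem_erase.2 ⟨hne.symm, Finset.mem_range.2 h₃.1.1⟩)
  refine le_trans ?_ hle
  have hcube : (ε / 2) ^ 3 ≤ g x₁ y₁ * g x₂ y₁ * g x₁ (y₁ + (x₂ - x₁)) := by
    rw [← hy, pow_succ, pow_two]
    exact mul_le_mul (mul_le_mul h₁.2 h₃.2 (by positivity) (hg _ _).1) h₂.2 (by positivity)
      (mul_nonneg (hg _ _).1 (hg _ _).1)
  refine le_trans ?_ hcube
  rw [div_mul_eq_mul_div, div_le_iff₀ (by positivity)]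
  gcongr
  have htot : ∑ i ∈ Finset.range n, ∑ j ∈ Finset.range n, g i j ≤ (n : ℝ) ^ 2 := by
    calc _ ≤ ∑ i ∈ Finset.range n, ∑ j ∈ Finset.range n, (1 : ℝ) :=
          Finset.sum_le_sum fun i _ => Finset.sum_le_sum fun j _ => (hg i j).2
      _ = _ := by simp; ring
  nlinarith [show 0 ≤ ε * (n : ℝ) ^ 2 by positivity]

theorem continuous_psiHat (ψ : SchwartzMap ℝ ℝ) : Continuous (psiHat fun x => ψ x) := by
  refine continuous_of_dominated (bound := fun x => ‖ψ x‖) (fun ξ => ?_) (fun ξ => ?_)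
    ψ.integrable.norm ?_
  · exact Continuous.aestronglyMeasurable (by fun_prop)
  · refine Filter.Eventually.of_forall fun x => le_of_eq ?_
    rw [norm_mul, Complex.norm_real, Complex.norm_exp]
    simp
  · exact Filter.Eventually.of_forall fun x => by fun_prop

/-- A bounded measurable function supported in a set of finite measure is integrable. -/
theorem integrable_of_bounded_of_support_subset {α : Type*} [MeasurableSpace α] {μ : Measure α}
    {f : α → ℝ} (hf : Measurable f) {s : Set α} (hs : μ s ≠ ⊤) (hsupp : Function.support f ⊆ s)
    {C : ℝ} (hC : ∀ a, |f a| ≤ C) : Integrable f μ := by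
  rw [← integrableOn_iff_integrable_of_support_subset hsupp]
  exact Measure.integrableOn_of_bounded (M := C) hs hf.aestronglyMeasurable
    (Filter.Eventually.of_forall hC)

/-- The product of `f` over the corner `z, z + (s, 0), z + (0, s)`. -/
def cornerProd {E : Type*} [Add E] (f : E × E → ℝ) (z : E × E) (s : E) : ℝ :=
  f z * f (z.1 + s, z.2) * f (z.1, z.2 + s)

section

variable {d : ℕ} {f : (Fin d → ℝ) × (Fin d → ℝ) → ℝ} {N : ℝ}

theorem cornerProd_mem_Icc (h01 : ∀ z, f z ∈ Set.Icc (0 : ℝ) 1) (z : (Fin d → ℝ) × (Fin d → ℝ))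
    (s : Fin d → ℝ) : cornerProd f z s ∈ Set.Icc (0 : ℝ) 1 :=
  ⟨mul_nonneg (mul_nonneg (h01 _).1 (h01 _).1) (h01 _).1,
    mul_le_one₀ (mul_le_one₀ (h01 _).2 (h01 _).1 (h01 _).2) (h01 _).1 (h01 _).2⟩

theorem measurable_cornerProd (hm : Measurable f) :
    Measurable fun q : ((Fin d → ℝ) × (Fin d → ℝ)) × (Fin d → ℝ) => cornerProd f q.1 q.2 := by
  unfold cornerProd
  fun_prop

theorem integrable_of_support_cube (hm : Measurable f) (h01 : ∀ z, f z ∈ Set.Icc (0 : ℝ) 1)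
    (hsupp : ∀ z, f z ≠ 0 →
      z ∈ Set.Icc (0 : Fin d → ℝ) (fun _ => N) ×ˢ Set.Icc (0 : Fin d → ℝ) (fun _ => N)) :
    Integrable f :=
  integrable_of_bounded_of_support_subset hm (isCompact_Icc.prod isCompact_Icc).measure_ne_top
    hsupp (C := 1) fun z => by rw [abs_of_nonneg (h01 z).1]; exact (h01 z).2

theorem integrable_cornerProd_mul (hm : Measurable f) (h01 : ∀ z, f z ∈ Set.Icc (0 : ℝ) 1)
    (hsupp : ∀ z, f z ≠ 0 →
      z ∈ Set.Icc (0 : Fin d → ℝ) (fun _ => N) ×ˢ Set.Icc (0 : Fin d → ℝ) (fun _ => N))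
    {w : (Fin d → ℝ) → ℝ} (hw : Measurable w) {C : ℝ} (hC : ∀ s, |w s| ≤ C) :
    Integrable fun q : ((Fin d → ℝ) × (Fin d → ℝ)) × (Fin d → ℝ) =>
      cornerProd f q.1 q.2 * w q.2 := by
  refine integrable_of_bounded_of_support_subset (C := C)
    ((measurable_cornerProd hm).mul (hw.comp measurable_snd))
    (s := (Set.Icc (0 : Fin d → ℝ) (fun _ => N) ×ˢ Set.Icc (0 : Fin d → ℝ) (fun _ => N)) ×ˢ
      Set.Icc (fun _ => -N) (fun _ => N))
    ((isCompact_Icc.prod isCompact_Icc).prod isCompact_Icc).measure_ne_top ?_ fun q => ?_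
  · rintro ⟨z, s⟩ hq
    have h := left_ne_zero_of_mul hq
    have h₁ := hsupp _ (left_ne_zero_of_mul (left_ne_zero_of_mul h))
    have h₂ := hsupp _ (right_ne_zero_of_mul (left_ne_zero_of_mul h))
    refine ⟨h₁, fun i => ?_, fun i => ?_⟩
    · have := h₁.1.2 i
      have := h₂.1.1 i
      simp only [Pi.add_apply, Pi.zero_apply] at *
      linarith
    · have := h₁.1.1 i
      have := h₂.1.2 i
      simp only [Pi.add_apply, Pi.zero_apply] at *
      linarith
  · have h := cornerProd_mem_Icc h01 q.1 q.2
    rw [abs_mul, abs_of_nonneg h.1]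
    exact (mul_le_of_le_one_left (abs_nonneg _) h.2).trans (hC _)

theorem integrable_cornerProd (hm : Measurable f) (h01 : ∀ z, f z ∈ Set.Icc (0 : ℝ) 1)
    (hsupp : ∀ z, f z ≠ 0 →
      z ∈ Set.Icc (0 : Fin d → ℝ) (fun _ => N) ×ˢ Set.Icc (0 : Fin d → ℝ) (fun _ => N))
    (s : Fin d → ℝ) : Integrable fun z => cornerProd f z s := by
  refine (integrable_of_support_cube hm h01 hsupp).mono'
    ((measurable_cornerProd hm).comp (measurable_id.prodMk measurable_const)).aestronglyMeasurable
    (Filter.Eventually.of_forall fun z => ?_)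
  rw [Real.norm_of_nonneg (cornerProd_mem_Icc h01 z s).1, cornerProd, mul_assoc]
  exact mul_le_of_le_one_right (h01 z).1 (mul_le_one₀ (h01 _).2 (h01 _).1 (h01 _).2)

theorem integrable_integral_cornerProd (hm : Measurable f) (h01 : ∀ z, f z ∈ Set.Icc (0 : ℝ) 1)
    (hsupp : ∀ z, f z ≠ 0 →
      z ∈ Set.Icc (0 : Fin d → ℝ) (fun _ => N) ×ˢ Set.Icc (0 : Fin d → ℝ) (fun _ => N)) :
    Integrable fun s => ∫ z, cornerProd f z s := by
  have h := integrable_cornerProd_mul hm h01 hsupp (w := fun _ => 1) measurable_const (C := 1)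
    (by simp)
  simp only [mul_one] at h
  exact h.integral_prod_right

/-- Fubini for a weighted count of corners. -/
theorem integral_cornerProd_mul (hm : Measurable f) (h01 : ∀ z, f z ∈ Set.Icc (0 : ℝ) 1)
    (hsupp : ∀ z, f z ≠ 0 →
      z ∈ Set.Icc (0 : Fin d → ℝ) (fun _ => N) ×ˢ Set.Icc (0 : Fin d → ℝ) (fun _ => N))
    {w : (Fin d → ℝ) → ℝ} (hw : Measurable w) {C : ℝ} (hC : ∀ s, |w s| ≤ C) :
    ∫ x, ∫ y, ∫ s, f (x, y) * f (x + s, y) * f (x, y + s) * w s =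
      ∫ s, (∫ z, cornerProd f z s) * w s := by
  have h := integrable_cornerProd_mul hm h01 hsupp hw hC
  have h₁ := integral_prod (μ := (volume : Measure (Fin d → ℝ)))
    (ν := (volume : Measure (Fin d → ℝ))) _ h.integral_prod_left
  simp only [cornerProd] at h₁
  rw [← h₁]
  change ∫ z, ∫ s, cornerProd f z s * w s = _
  rw [integral_integral_swap h]
  simp only [integral_mul_const]

/-- The corner count along the progressions with common difference `v`. -/
theorem sum_integral_cornerProd_lower_bound {n : ℕ} (hn : 0 < n) {c ε : ℝ}
    (hcorner : ∀ g : ℤ → ℤ → ℝ, (∀ i j, g i j ∈ Set.Icc (0 : ℝ) 1) →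
      c * (∑ i ∈ Finset.range n, ∑ j ∈ Finset.range n, g i j - ε * n ^ 2) ≤
        ∑ i ∈ Finset.range n, ∑ j ∈ Finset.range n, ∑ k ∈ (Finset.range n).erase i,
          g i j * g k j * g i (j + (k - i)))
    (hm : Measurable f) (h01 : ∀ z, f z ∈ Set.Icc (0 : ℝ) 1) (hN : 0 ≤ N)
    (hsupp : ∀ z, f z ≠ 0 →
      z ∈ Set.Icc (0 : Fin d → ℝ) (fun _ => N) ×ˢ Set.Icc (0 : Fin d → ℝ) (fun _ => N))
    (v : Fin d → ℝ) (hv : n * ‖v‖ ≤ N) :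
    c * n * ((∫ z, f z) - ε * (3 * N) ^ (2 * d)) ≤
      ∑ i ∈ Finset.range n, ∑ k ∈ (Finset.range n).erase i,
        ∫ z, cornerProd f z (((k : ℝ) - i) • v) := by
  have hfint := integrable_of_support_cube hm h01 hsupp
  set B : Set ((Fin d → ℝ) × (Fin d → ℝ)) :=
    Set.Icc (fun _ => -N) (fun _ => 2 * N) ×ˢ Set.Icc (fun _ => -N) (fun _ => 2 * N) with hB
  have hBm : MeasurableSet B := measurableSet_Icc.prod measurableSet_Icc
  have hBtop : volume B ≠ ⊤ := (isCompact_Icc.prod isCompact_Icc).measure_ne_top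
  have hBvol : volume.real B = (3 * N) ^ (2 * d) := by
    rw [hB, Measure.volume_eq_prod, measureReal_prod_prod, Measure.real,
      Real.volume_Icc_pi_toReal fun _ => by linarith, Finset.prod_const, Finset.card_univ,
      Fintype.card_fin, two_mul d, pow_add]
    ring
  let sh : ℤ → ℤ → (Fin d → ℝ) × (Fin d → ℝ) := fun i j => ((i : ℝ) • v, (j : ℝ) • v)
  have hpt : ∀ z, c * (∑ i ∈ Finset.range n, ∑ j ∈ Finset.range n, f (z + sh i j)
        - B.indicator (fun _ => ε * n ^ 2) z) ≤
      ∑ i ∈ Finset.range n, ∑ j ∈ Finset.range n, ∑ k ∈ (Finset.range n).erase i,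
        cornerProd f (z + sh i j) (((k : ℝ) - i) • v) := by
    intro z
    by_cases hz : z ∈ B
    · rw [Set.indicator_of_mem hz]
      refine (hcorner (fun i j => f (z + sh i j)) fun i j => h01 _).trans (le_of_eq ?_)
      refine Finset.sum_congr rfl fun i _ => Finset.sum_congr rfl fun j _ =>
        Finset.sum_congr rfl fun k _ => ?_
      have e₁ : z + sh k j =
          ((z + sh i j).1 + ((k : ℝ) - i) • v, (z + sh i j).2) := by
        ext <;> simp [sh] <;> ring
      have e₂ : z + sh i (j + (k - i)) =
          ((z + sh i j).1, (z + sh i j).2 + ((k : ℝ) - i) • v) := by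
        ext <;> simp [sh] <;> ring
      rw [cornerProd, ← e₁, ← e₂]
    · rw [Set.indicator_of_notMem hz, sub_zero, Finset.sum_eq_zero, mul_zero]
      · exact Finset.sum_nonneg fun i _ => Finset.sum_nonneg fun j _ =>
          Finset.sum_nonneg fun k _ => (cornerProd_mem_Icc h01 _ _).1
      · refine fun i hi => Finset.sum_eq_zero fun j hj => ?_
        by_contra hne
        apply hz
        have hmem := hsupp _ hne
        have key : ∀ i ∈ Finset.range n, ∀ l, |(i : ℝ) * v l| ≤ N := by
          intro i hi l
          rw [abs_mul, Nat.abs_cast]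
          refine le_trans ?_ hv
          have := norm_le_pi_norm v l
          have : (i : ℝ) ≤ n := by exact_mod_cast (Finset.mem_range.1 hi).le
          rw [Real.norm_eq_abs] at *
          gcongr
        refine ⟨⟨fun l => ?_, fun l => ?_⟩, fun l => ?_, fun l => ?_⟩
        · have h₁ := hmem.1.1 l
          have h₂ := abs_le.1 (key i hi l)
          simp [sh] at h₁ ⊢
          linarith
        · have h₁ := hmem.1.2 l
          have h₂ := abs_le.1 (key i hi l)
          simp [sh] at h₁ ⊢
          linarith
        · have h₁ := hmem.2.1 l
          have h₂ := abs_le.1 (key j hj l)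
          simp [sh] at h₁ ⊢
          linarith
        · have h₁ := hmem.2.2 l
          have h₂ := abs_le.1 (key j hj l)
          simp [sh] at h₁ ⊢
          linarith
  have : (volume : Measure ((Fin d → ℝ) × (Fin d → ℝ))).IsAddRightInvariant := by
    rw [Measure.volume_eq_prod]
    infer_instance
  have hI₁ : ∀ i j : ℕ, Integrable fun z => f (z + sh i j) := fun i j => hfint.comp_add_right _
  have hI₂ : ∀ i j k : ℕ, Integrable fun z =>
      cornerProd f (z + sh i j) (((k : ℝ) - i) • v) := fun i j k =>
    (integrable_cornerProd hm h01 hsupp _).comp_add_right _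
  have hIB : Integrable (B.indicator fun _ => ε * (n : ℝ) ^ 2) :=
    (integrable_indicator_iff hBm).2 (integrableOn_const hBtop)
  have hIs : Integrable fun z => ∑ i ∈ Finset.range n, ∑ j ∈ Finset.range n, f (z + sh i j) :=
    integrable_finsetSum _ fun i _ => integrable_finsetSum _ fun j _ => hI₁ i j
  have hint := integral_mono ((hIs.sub hIB).const_mul c)
    (integrable_finsetSum _ fun i _ => integrable_finsetSum _ fun j _ =>
      integrable_finsetSum _ fun k _ => hI₂ i j k) hpt
  simp only [Pi.sub_apply] at hint
  rw [integral_const_mul, integral_sub hIs hIB, integral_indicator hBm, setIntegral_const,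
    hBvol, integral_finsetSum _ fun i _ => integrable_finsetSum _ fun j _ => hI₁ i j,
    integral_finsetSum _ fun i _ => integrable_finsetSum _ fun j _ =>
      integrable_finsetSum _ fun k _ => hI₂ i j k] at hint
  have hL : ∀ i ∈ Finset.range n, ∫ z, ∑ j ∈ Finset.range n, f (z + sh i j) = n * ∫ z, f z := by
    intro i _
    rw [integral_finsetSum _ fun j _ => hI₁ i j]
    simp [integral_add_right_eq_self]
  have hR : ∀ i ∈ Finset.range n, ∫ z, ∑ j ∈ Finset.range n, ∑ k ∈ (Finset.range n).erase i,
        cornerProd f (z + sh i j) (((k : ℝ) - i) • v) =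
      n * ∑ k ∈ (Finset.range n).erase i, ∫ z, cornerProd f z (((k : ℝ) - i) • v) := by
    intro i _
    rw [integral_finsetSum _ fun j _ => integrable_finsetSum _ fun k _ => hI₂ i j k]
    have : ∀ j ∈ Finset.range n, ∫ z, ∑ k ∈ (Finset.range n).erase i,
        cornerProd f (z + sh i j) (((k : ℝ) - i) • v) =
          ∑ k ∈ (Finset.range n).erase i, ∫ z, cornerProd f z (((k : ℝ) - i) • v) := by
      intro j _
      rw [integral_finsetSum _ fun k _ => hI₂ i j k]
      exact Finset.sum_congr rfl fun k _ =>
        integral_add_right_eq_self (fun z => cornerProd f z (((k : ℝ) - i) • v)) (sh i j)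
    rw [Finset.sum_congr rfl this]
    simp
  rw [Finset.sum_congr rfl hL, Finset.sum_congr rfl hR] at hint
  simp only [← Finset.mul_sum, Finset.sum_const, Finset.card_range, nsmul_eq_mul, smul_eq_mul] at hint
  have hn' : (0 : ℝ) < n := by exact_mod_cast hn
  refine le_of_mul_le_mul_left (le_trans (le_of_eq ?_) hint) hn'
  ring

/-- Rescaling by a factor of absolute value at least one only enlarges the integral of a nonnegative function. -/
theorem setIntegral_closedBall_comp_smul_le {F : (Fin d → ℝ) → ℝ} (hF : Integrable F)
    (hF0 : ∀ s, 0 ≤ F s) {a r R : ℝ} (ha : 1 ≤ |a|) (har : |a| * r ≤ R) :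
    ∫ v in Metric.closedBall 0 r, F (a • v) ≤ ∫ s in Metric.closedBall 0 R, F s := by
  have ha0 : a ≠ 0 := by
    rintro rfl
    norm_num at ha
  rw [Measure.setIntegral_comp_smul _ _ _ ha0, smul_eq_mul, smul_closedBall' ha0, smul_zero]
  refine (mul_le_of_le_one_left (integral_nonneg fun _ => hF0 _) ?_).trans ?_
  · rw [abs_inv, abs_pow]
    exact inv_le_one_of_one_le₀ (one_le_pow₀ ha)
  · exact setIntegral_mono_set hF.integrableOn (Filter.Eventually.of_forall hF0)
      (Metric.closedBall_subset_closedBall har).eventuallyLE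

/-- Corners with side at most `r` are abundant. -/
theorem exists_setIntegral_cornerProd_lower_bound (d : ℕ) (δ : ℝ) (hδ : 0 < δ) :
    ∃ c : ℝ, 0 < c ∧ ∀ r N : ℝ, 0 < r → r ≤ N → ∀ f : (Fin d → ℝ) × (Fin d → ℝ) → ℝ,
      Measurable f → (∀ z, f z ∈ Set.Icc (0 : ℝ) 1) →
      (∀ z, f z ≠ 0 →
        z ∈ Set.Icc (0 : Fin d → ℝ) (fun _ => N) ×ˢ Set.Icc (0 : Fin d → ℝ) (fun _ => N)) →
      δ * N ^ (2 * d) ≤ ∫ z, f z →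
      c * r ^ d * N ^ (2 * d) ≤ ∫ s in Metric.closedBall 0 r, ∫ z, cornerProd f z s := by
  obtain ⟨n, hn, c, hc, hcorner⟩ :=
    exists_corner_sum_lower_bound (δ / (2 * 3 ^ (2 * d))) (by positivity)
  have hn' : (0 : ℝ) < n := by exact_mod_cast hn
  refine ⟨(2 / n) ^ d * (c * (δ / 2)) / n, by positivity, ?_⟩
  intro r N hr hrN f hm h01 hsupp hδf
  have hN : 0 < N := hr.trans_le hrN
  set F : (Fin d → ℝ) → ℝ := fun s => ∫ z, cornerProd f z s
  have hF : Integrable F := integrable_integral_cornerProd hm h01 hsupp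
  have hF0 : ∀ s, 0 ≤ F s := fun s => integral_nonneg fun z => (cornerProd_mem_Icc h01 z s).1
  have hpt : ∀ v ∈ Metric.closedBall (0 : Fin d → ℝ) (r / n), c * n * (δ / 2 * N ^ (2 * d)) ≤
      ∑ i ∈ Finset.range n, ∑ k ∈ (Finset.range n).erase i, F (((k : ℝ) - i) • v) := by
    intro v hv
    rw [mem_closedBall_zero_iff, le_div_iff₀ hn'] at hv
    refine le_trans ?_ (sum_integral_cornerProd_lower_bound hn hcorner hm h01 hN.le hsupp v
      (by linarith))
    gcongr
    rw [mul_pow]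
    field_simp
    field_simp at hδf
    linarith
  have hne : ∀ i, ∀ k ∈ (Finset.range n).erase i, (k : ℝ) - i ≠ 0 := fun i k hk =>
    sub_ne_zero.2 (by exact_mod_cast (Finset.mem_erase.1 hk).1)
  have hI : ∀ i, ∀ k ∈ (Finset.range n).erase i, IntegrableOn (fun v => F (((k : ℝ) - i) • v))
      (Metric.closedBall 0 (r / n)) := fun i k hk =>
    (hF.comp_smul (hne i k hk)).integrableOn
  have hvol : volume.real (Metric.closedBall (0 : Fin d → ℝ) (r / n)) = (2 * (r / n)) ^ d := by
    rw [Measure.real, Real.volume_pi_closedBall _ (by positivity),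
      ENNReal.toReal_ofReal (by positivity), Fintype.card_fin]
  have hint := setIntegral_mono_on (integrableOn_const measure_closedBall_lt_top.ne)
    (integrable_finsetSum _ fun i _ => integrable_finsetSum _ fun k hk => hI i k hk)
    measurableSet_closedBall hpt
  rw [setIntegral_const, hvol, smul_eq_mul,
    integral_finsetSum _ fun i _ => integrable_finsetSum _ fun k hk => hI i k hk] at hint
  have hsum : ∑ i ∈ Finset.range n, ∫ v in Metric.closedBall 0 (r / n),
      ∑ k ∈ (Finset.range n).erase i, F (((k : ℝ) - i) • v) ≤
        ∑ i ∈ Finset.range n, ∑ k ∈ Finset.range n, ∫ s in Metric.closedBall 0 r, F s := by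
    refine Finset.sum_le_sum fun i hi => ?_
    rw [integral_finsetSum _ fun k hk => hI i k hk]
    refine (Finset.sum_le_sum fun k hk => ?_).trans (Finset.sum_le_sum_of_subset_of_nonneg
      (Finset.erase_subset _ _) fun _ _ _ => integral_nonneg fun _ => hF0 _)
    have hik := (Finset.mem_erase.1 hk).1
    have hkn := Finset.mem_range.1 (Finset.mem_erase.1 hk).2
    have hin := Finset.mem_range.1 hi
    refine setIntegral_closedBall_comp_smul_le hF hF0 ?_ ?_
    · have : (1 : ℤ) ≤ |(k : ℤ) - i| := Int.one_le_abs (by omega)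
      exact_mod_cast this
    · have : |(k : ℤ) - i| ≤ n := abs_le.2 ⟨by omega, by omega⟩
      have : |(k : ℝ) - i| ≤ n := by exact_mod_cast this
      calc |(k : ℝ) - i| * (r / n) ≤ n * (r / n) := by gcongr
        _ = r := by field_simp
  simp only [Finset.sum_const, Finset.card_range, nsmul_eq_mul] at hsum
  have := hint.trans hsum
  rw [mul_pow, div_pow] at this
  rw [div_pow]
  field_simp
  field_simp at this
  linarith

end

theorem Mform_lower_bound (p : ℝ) (hp : 1 < p) (d : ℕ) (hd : 1 ≤ d)
    (δ : ℝ) (hδ0 : 0 < δ) (hδ1 : δ ≤ 1)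
    (ψ : SchwartzMap ℝ ℝ) (hψ01 : ∀ x, ψ x ∈ Set.Icc (0 : ℝ) 1) (hψ0 : ψ 0 = 1)
    (hψhat_re : ∀ ξ, 0 ≤ (psiHat (fun x => ψ x) ξ).re)
    (hψhat_im : ∀ ξ, (psiHat (fun x => ψ x) ξ).im = 0)
    (hψhat_supp : HasCompactSupport (psiHat (fun x => ψ x)))
    (hψhat1 : 0 < (psiHat (fun x => ψ x) 1).re) :
    ∃ c : ℝ, 0 < c ∧ ∀ lam N : ℝ, 0 < lam → lam ≤ N →
      ∀ f : (Fin d → ℝ) × (Fin d → ℝ) → ℝ, Measurable f →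
        (∀ z, f z ∈ Set.Icc (0 : ℝ) 1) →
        (∀ z, f z ≠ 0 →
          z ∈ Set.Icc (0 : Fin d → ℝ) (fun _ => N) ×ˢ Set.Icc (0 : Fin d → ℝ) (fun _ => N)) →
        δ * N ^ (2 * d) ≤ ∫ z : (Fin d → ℝ) × (Fin d → ℝ), f z →
        c * N ^ (2 * d) ≤ Mform (fun x => ψ x) p d lam 1 f := by
  obtain ⟨c, hc, hcount⟩ := exists_setIntegral_cornerProd_lower_bound d δ hδ0
  set h : ℝ → ℝ := fun ξ => (psiHat (fun x => ψ x) ξ).re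
  have hcont : Continuous h := Complex.continuous_re.comp (continuous_psiHat ψ)
  obtain ⟨C, hC⟩ := hψhat_supp.exists_bound_of_continuous (continuous_psiHat ψ)
  have hsum : Continuous fun t : Fin d → ℝ => 1 - ∑ i, |t i| ^ p :=
    continuous_const.sub <| continuous_finsetSum _ fun i _ =>
      (continuous_apply i).abs.rpow_const fun _ => Or.inr (by linarith)
  have hev : ∀ᶠ t : Fin d → ℝ in nhds 0, h 1 / 2 < h (1 - ∑ i, |t i| ^ p) := by
    refine (hcont.comp hsum).continuousAt.eventually_const_lt ?_
    simp only [Function.comp_apply, Pi.zero_apply, abs_zero,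
      Real.zero_rpow (by linarith : p ≠ 0), Finset.sum_const_zero, sub_zero]
    exact half_lt_self hψhat1
  obtain ⟨η₀, hη₀, hball⟩ := Metric.nhds_basis_closedBall.eventually_iff.1 hev
  set η := min η₀ 1
  have hη : 0 < η := lt_min hη₀ one_pos
  have hh1 : 0 < h 1 := hψhat1
  refine ⟨h 1 / 2 * (c * η ^ d), by positivity, ?_⟩
  intro lam N hlam hlamN f hm h01 hsupp hδf
  have hw : Measurable (omegaFn (fun x => ψ x) p d lam 1) := by
    refine Continuous.measurable (continuous_const.mul ?_)
    refine hcont.comp (continuous_const.mul ?_)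
    exact hsum.comp (continuous_const_smul (lam⁻¹))
  have hw0 : ∀ s, 0 ≤ omegaFn (fun x => ψ x) p d lam 1 s := fun s =>
    mul_nonneg (by positivity) (hψhat_re _)
  have hwC : ∀ s, |omegaFn (fun x => ψ x) p d lam 1 s| ≤ (lam ^ d)⁻¹ * 1⁻¹ * C := by
    intro s
    rw [omegaFn, abs_mul, abs_of_nonneg (by positivity : 0 ≤ (lam ^ d)⁻¹ * (1 : ℝ)⁻¹)]
    gcongr
    exact (Complex.abs_re_le_norm _).trans (hC _)
  have hF := integrable_integral_cornerProd hm h01 hsupp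
  have hF0 : ∀ s, 0 ≤ ∫ z, cornerProd f z s := fun s =>
    integral_nonneg fun z => (cornerProd_mem_Icc h01 z s).1
  have hFw : Integrable fun s => (∫ z, cornerProd f z s) * omegaFn (fun x => ψ x) p d lam 1 s :=
    hF.mul_bdd hw.aestronglyMeasurable (Filter.Eventually.of_forall hwC)
  have hηlam : η * lam ≤ N := (mul_le_of_le_one_left hlam.le (min_le_right _ _)).trans hlamN
  have hlow : ∀ s ∈ Metric.closedBall (0 : Fin d → ℝ) (η * lam),
      (∫ z, cornerProd f z s) * ((lam ^ d)⁻¹ * (h 1 / 2)) ≤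
        (∫ z, cornerProd f z s) * omegaFn (fun x => ψ x) p d lam 1 s := by
    intro s hs
    refine mul_le_mul_of_nonneg_left ?_ (hF0 s)
    rw [omegaFn, inv_one, mul_one, one_mul]
    refine mul_le_mul_of_nonneg_left (hball (x := lam⁻¹ • s) ?_).le (by positivity)
    rw [mem_closedBall_zero_iff] at hs ⊢
    rw [norm_smul, norm_inv, Real.norm_of_nonneg hlam.le, inv_mul_le_iff₀ hlam, mul_comm]
    exact hs.trans (by gcongr; exact min_le_left _ _)
  rw [Mform, integral_cornerProd_mul hm h01 hsupp hw hwC]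
  calc h 1 / 2 * (c * η ^ d) * N ^ (2 * d)
      = c * (η * lam) ^ d * N ^ (2 * d) * ((lam ^ d)⁻¹ * (h 1 / 2)) := by
        rw [mul_pow]
        field_simp
    _ ≤ (∫ s in Metric.closedBall 0 (η * lam), ∫ z, cornerProd f z s) *
          ((lam ^ d)⁻¹ * (h 1 / 2)) := by
        gcongr
        exact hcount _ N (by positivity) hηlam f hm h01 hsupp hδf
    _ = ∫ s in Metric.closedBall 0 (η * lam), (∫ z, cornerProd f z s) *
          ((lam ^ d)⁻¹ * (h 1 / 2)) := (integral_mul_const _ _).symm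
    _ ≤ ∫ s in Metric.closedBall 0 (η * lam), (∫ z, cornerProd f z s) *
          omegaFn (fun x => ψ x) p d lam 1 s :=
        setIntegral_mono_on (hF.mul_const _).integrableOn hFw.integrableOn
          measurableSet_closedBall hlow
    _ ≤ ∫ s, (∫ z, cornerProd f z s) * omegaFn (fun x => ψ x) p d lam 1 s :=
        setIntegral_le_integral hFw
          (Filter.Eventually.of_forall fun s => mul_nonneg (hF0 s) (hw0 s))
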